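/- arXiv:0904.4206 — 2 statements merged into one kernel-verified Lean document; each statement's English description precedes it below -/
import Mathlib

section
/- If a ∈ α satisfies τ(a) = a, then the étale phrase of length k over α whose l-th component is the word aaa and whose other components are empty is homotopic to the empty phrase (∅)_k. -/
namespace Nano

variable {α : Type*}

/-- A letter: an identifier together with its projection to the alphabet `α`. -/
abbrev Letter (α : Type*) := ℕ × α

/-- The projection of a letter. -/
def proj (A : Letter α) : α := A.2

/-- A phrase: a finite sequence of words, each word a list of letters. -/
abbrev Phrase (α : Type*) := List (List (Letter α))

/-- Flatten a phrase into one list, separating components by `none` (the `|` character). -/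
def flat (P : Phrase α) : List (Option (Letter α)) :=
  List.intercalate [none] (P.map fun w => w.map some)

/-- The `i`-th component (word) of a phrase (0-indexed). -/
def comp (P : Phrase α) (i : ℕ) : List (Letter α) := P.getD i []

/-- A phrase is a Gauss phrase if every letter occurring in it occurs exactly twice. -/
def IsGauss [DecidableEq α] (P : Phrase α) : Prop :=
  ∀ A ∈ P.flatten, P.flatten.count A = 2

/-- All letters of `P` project into the subset `β` of `α`. -/
def ProjIn (β : Set α) (P : Phrase α) : Prop := ∀ A ∈ P.flatten, A.2 ∈ β

/-- Renaming of letters (injective renamings give isomorphisms of `α`-alphabets,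
preserving the projection). -/
def rename (f : ℕ → ℕ) (P : Phrase α) : Phrase α :=
  P.map (List.map fun A => (f A.1, A.2))

/-- One elementary step: an isomorphism or one of the homotopy moves (1)-(3),
for the involution `τ` on `α`. -/
inductive Move (τ : α → α) : Phrase α → Phrase α → Prop
  | iso (f : ℕ → ℕ) (hf : Function.Injective f) (P : Phrase α) :
      Move τ P (rename f P)
  | h1 (P Q : Phrase α) (A : Letter α) (x y : List (Option (Letter α)))
      (hP : flat P = x ++ [some A, some A] ++ y)
      (hQ : flat Q = x ++ y) : Move τ P Q
  | h2 (P Q : Phrase α) (A B : Letter α) (x y z : List (Option (Letter α)))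
      (hAB : B.2 = τ A.2)
      (hP : flat P = x ++ [some A, some B] ++ y ++ [some B, some A] ++ z)
      (hQ : flat Q = x ++ y ++ z) : Move τ P Q
  | h3 (P Q : Phrase α) (A B C : Letter α) (x y z t : List (Option (Letter α)))
      (hAB : A.2 = B.2) (hBC : B.2 = C.2)
      (hP : flat P = x ++ [some A, some B] ++ y ++ [some A, some C] ++ z
              ++ [some B, some C] ++ t)
      (hQ : flat Q = x ++ [some B, some A] ++ y ++ [some C, some A] ++ z
              ++ [some C, some B] ++ t) : Move τ P Q

/-- A nanophrase over the subset `β`: a Gauss phrase all of whose letters project into `β`. -/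
def NanoIn [DecidableEq α] (β : Set α) (P : Phrase α) : Prop := IsGauss P ∧ ProjIn β P

/-- Homotopy of nanophrases in the class of nanophrases over `β ⊆ α`:
a finite chain of isomorphisms, moves (1)-(3) and their inverses, all whose
terms are nanophrases over `β`. -/
def HomotopicIn [DecidableEq α] (τ : α → α) (β : Set α) (P Q : Phrase α) : Prop :=
  Relation.ReflTransGen
    (fun X Y => (Move τ X Y ∨ Move τ Y X) ∧ NanoIn β X ∧ NanoIn β Y) P Q

/-- Homotopy of nanophrases over `α`. -/
def Homotopic [DecidableEq α] (τ : α → α) (P Q : Phrase α) : Prop :=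
  HomotopicIn τ Set.univ P Q

/-! ### Desingularization -/

/-- The letter `A_{p,q}` of the desingularized alphabet. -/
def dLetter (A : Letter α) (p q : ℕ) : Letter α := (Nat.pair A.1 (Nat.pair p q), A.2)

/-- The replacement of the `i`-th occurrence (1-indexed) of a letter `A` of
multiplicity `m`: `A_{1,i} A_{2,i} ⋯ A_{i-1,i} A_{i,i+1} ⋯ A_{i,m}`. -/
def repl (A : Letter α) (i m : ℕ) : List (Letter α) :=
  ((List.range (i - 1)).map fun j => dLetter A (j + 1) i) ++
  ((List.range (m - i)).map fun j => dLetter A i (i + j + 1))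

def desingWord [DecidableEq α] (m : Letter α → ℕ) :
    List (Letter α) → (Letter α → ℕ) → List (Letter α)
  | [], _ => []
  | A :: rest, seen =>
      repl A (seen A + 1) (m A) ++
        desingWord m rest (fun B => if B = A then seen B + 1 else seen B)

def desingAux [DecidableEq α] (m : Letter α → ℕ) :
    Phrase α → (Letter α → ℕ) → Phrase α
  | [], _ => []
  | w :: ws, seen => desingWord m w seen :: desingAux m ws (fun B => seen B + w.count B)

/-- The desingularization `P^d` of an étale phrase `P`. -/
def desing [DecidableEq α] (P : Phrase α) : Phrase α :=
  desingAux (fun A => P.flatten.count A) P (fun _ => 0)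

/-- Homotopy of étale phrases: homotopy of their desingularizations. -/
def EHomotopic [DecidableEq α] (τ : α → α) (P Q : Phrase α) : Prop :=
  Homotopic τ (desing P) (desing Q)

/-! ### Phrases over `α` itself, via the identity projection -/

/-- An element of `α` regarded as a letter (identity projection). -/
def ofα (a : α) : Letter α := (0, a)

/-- The empty phrase `(∅)_k` of length `k`. -/
def emptyP (k : ℕ) : Phrase α := List.replicate k []

/-- `P^{1,1;l₁,l₂}_a`. -/
def P11 (k : ℕ) (l1 l2 : Fin k) (a : α) : Phrase α :=
  List.ofFn fun i => if i = l1 ∨ i = l2 then [ofα a] else []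

/-- `P^{3;l}_a`. -/
def P3 (k : ℕ) (l : Fin k) (a : α) : Phrase α :=
  List.ofFn fun i => if i = l then [ofα a, ofα a, ofα a] else []

/-- `P^{2,1;l₁,l₂}_a`. -/
def P21 (k : ℕ) (l1 l2 : Fin k) (a : α) : Phrase α :=
  List.ofFn fun i => if i = l1 then [ofα a, ofα a] else if i = l2 then [ofα a] else []

/-- `P^{1,2;l₁,l₂}_a`. -/
def P12 (k : ℕ) (l1 l2 : Fin k) (a : α) : Phrase α :=
  List.ofFn fun i => if i = l1 then [ofα a] else if i = l2 then [ofα a, ofα a] else []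

/-- `P^{1,1,1;l₁,l₂,l₃}_a`. -/
def P111 (k : ℕ) (l1 l2 l3 : Fin k) (a : α) : Phrase α :=
  List.ofFn fun i => if i = l1 ∨ i = l2 ∨ i = l3 then [ofα a] else []

/-- The phrase whose only possibly nonempty component, preceded by `p` and followed by `q` empty
components, is the word of letters named by `w`, all projecting to `a`. -/
def oneWord (p q : ℕ) (a : α) (w : List ℕ) : Phrase α :=
  List.replicate p [] ++ w.map (fun n => (n, a)) :: List.replicate q []

section OneWord

variable (p q : ℕ) (a : α)

lemma flatten_oneWord (w : List ℕ) :
    (oneWord p q a w).flatten = w.map fun n => (n, a) := by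
  simp [oneWord]

lemma flat_cons_cons (u v : List (Letter α)) (P : Phrase α) :
    flat (u :: v :: P) = u.map some ++ none :: flat (v :: P) := by
  simp [flat, List.intercalate]

lemma flat_cons_replicate_nil (u : List (Letter α)) :
    flat (u :: List.replicate q []) = u.map some ++ List.replicate q none := by
  induction q generalizing u with
  | zero => simp [flat, List.intercalate]
  | succ q ih =>
    rw [List.replicate_succ, flat_cons_cons, ih]
    simp [List.replicate_succ]

lemma flat_oneWord (w : List ℕ) :
    flat (oneWord p q a w) =
      List.replicate p none ++ w.map (fun n => some (n, a)) ++ List.replicate q none := by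
  induction p with
  | zero => simp [oneWord, flat_cons_replicate_nil]
  | succ p ih =>
    have h : flat (oneWord (p + 1) q a w) = none :: flat (oneWord p q a w) := by
      cases p <;> simp [oneWord, List.replicate_succ, flat_cons_cons]
    rw [h, ih]
    simp [List.replicate_succ]

lemma nanoIn_oneWord [DecidableEq α] {w : List ℕ} (hw : ∀ n ∈ w, w.count n = 2) :
    NanoIn Set.univ (oneWord p q a w) := by
  refine ⟨?_, fun _ _ => Set.mem_univ _⟩
  intro A hA
  rw [flatten_oneWord] at hA ⊢
  obtain ⟨n, hn, rfl⟩ := List.mem_map.1 hA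
  rw [List.count_map_of_injective w (fun n : ℕ => (n, a))
    (fun _ _ h => congrArg Prod.fst h), hw n hn]

lemma move_one_oneWord (τ : α → α) (x y : List ℕ) (A : ℕ) :
    Move τ (oneWord p q a (x ++ [A, A] ++ y)) (oneWord p q a (x ++ y)) := by
  refine Move.h1 _ _ (A, a) (List.replicate p none ++ x.map (fun n => some (n, a)))
    (y.map (fun n => some (n, a)) ++ List.replicate q none) ?_ ?_ <;>
  simp [flat_oneWord]

lemma move_two_oneWord (τ : α → α) (ha : τ a = a) (x y z : List ℕ) (A B : ℕ) :
    Move τ (oneWord p q a (x ++ [A, B] ++ y ++ [B, A] ++ z))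
      (oneWord p q a (x ++ y ++ z)) := by
  refine Move.h2 _ _ (A, a) (B, a) (List.replicate p none ++ x.map (fun n => some (n, a)))
    (y.map (fun n => some (n, a)))
    (z.map (fun n => some (n, a)) ++ List.replicate q none) ha.symm ?_ ?_ <;>
  simp [flat_oneWord]

lemma move_three_oneWord (τ : α → α) (x y z t : List ℕ) (A B C : ℕ) :
    Move τ (oneWord p q a (x ++ [A, B] ++ y ++ [A, C] ++ z ++ [B, C] ++ t))
      (oneWord p q a (x ++ [B, A] ++ y ++ [C, A] ++ z ++ [C, B] ++ t)) := by
  refine Move.h3 _ _ (A, a) (B, a) (C, a)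
    (List.replicate p none ++ x.map (fun n => some (n, a)))
    (y.map (fun n => some (n, a))) (z.map (fun n => some (n, a)))
    (t.map (fun n => some (n, a)) ++ List.replicate q none) rfl rfl ?_ ?_ <;>
  simp [flat_oneWord]

/-- The nanoword `ABACBC` on three letters with `τ`-fixed projection is contractible. -/
lemma homotopic_oneWord_nil [DecidableEq α] (τ : α → α) (ha : τ a = a) :
    Homotopic τ (oneWord p q a [25, 100, 25, 121, 100, 121]) (oneWord p q a []) := by
  have step {u v : List ℕ} {R : Phrase α}
      (h : Move τ (oneWord p q a u) (oneWord p q a v) ∨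
        Move τ (oneWord p q a v) (oneWord p q a u))
      (hu : ∀ n ∈ u, u.count n = 2) (hv : ∀ n ∈ v, v.count n = 2)
      (hR : Homotopic τ (oneWord p q a v) R) : Homotopic τ (oneWord p q a u) R :=
    Relation.ReflTransGen.head
      ⟨h, nanoIn_oneWord p q a hu, nanoIn_oneWord p q a hv⟩ hR
  refine step (.inl (move_three_oneWord p q a τ [] [] [] [] 25 100 121))
    (by decide) (by decide) ?_
  -- The next seven steps contract the subword `ACAC` of `BACACB`.
  refine step (.inr (move_two_oneWord p q a τ ha [100] [25, 121] [25, 121, 100] 0 1))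
    (by decide) (by decide) ?_
  refine step (.inr (move_two_oneWord p q a τ ha [100, 0] [1, 25, 121, 1, 0, 25, 121] [100] 2 3))
    (by decide) (by decide) ?_
  refine step (.inr (move_three_oneWord p q a τ [100, 0, 2] [25] [0, 25] [2, 100] 1 3 121))
    (by decide) (by decide) ?_
  refine step (.inl (move_two_oneWord p q a τ ha [100, 0, 2, 1] [1, 121, 0] [121, 2, 100] 3 25))
    (by decide) (by decide) ?_
  refine step (.inl (move_one_oneWord p q a τ [100, 0, 2] [121, 0, 121, 2, 100] 1))
    (by decide) (by decide) ?_
  refine step (.inl (move_two_oneWord p q a τ ha [100, 0] [0] [100] 2 121))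
    (by decide) (by decide) ?_
  refine step (.inl (move_one_oneWord p q a τ [100] [100] 0)) (by decide) (by decide) ?_
  refine step (.inl (move_one_oneWord p q a τ [] [] 100)) (by decide) (by decide) ?_
  exact Relation.ReflTransGen.refl

lemma desingAux_replicate_nil_append [DecidableEq α] (m seen : Letter α → ℕ) (P : Phrase α) :
    desingAux m (List.replicate p [] ++ P) seen =
      List.replicate p [] ++ desingAux m P seen := by
  induction p with
  | zero => rfl
  | succ p ih => simp [List.replicate_succ, desingAux, desingWord, ih]

lemma desingAux_replicate_nil [DecidableEq α] (m seen : Letter α → ℕ) :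
    desingAux m (List.replicate p []) seen = List.replicate p [] := by
  simpa [desingAux] using desingAux_replicate_nil_append p m seen []

lemma desing_oneWord_three [DecidableEq α] :
    desing (oneWord p q a [0, 0, 0]) = oneWord p q a [25, 100, 25, 121, 100, 121] := by
  unfold desing
  rw [flatten_oneWord]
  simp [oneWord, desingAux_replicate_nil_append, desingAux_replicate_nil, desingAux,
    desingWord, repl, dLetter, Nat.pair, List.range_succ]

lemma desing_emptyP [DecidableEq α] (k : ℕ) :
    desing (emptyP k : Phrase α) = emptyP k :=
  desingAux_replicate_nil k _ _

end OneWord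

lemma emptyP_eq_oneWord (a : α) {k : ℕ} (l : Fin k) :
    emptyP k = oneWord l (k - 1 - l) a [] := by
  rw [emptyP, oneWord, List.map_nil, ← List.replicate_succ, List.replicate_append_replicate]
  congr 1
  omega

lemma P3_eq_oneWord (a : α) {k : ℕ} (l : Fin k) :
    P3 k l a = oneWord l (k - 1 - l) a [0, 0, 0] := by
  apply List.ext_getElem
  · simp [P3, oneWord]
    omega
  · intro i h₁ h₂
    simp only [P3, oneWord, List.getElem_ofFn, List.getElem_append, List.getElem_cons,
      List.getElem_replicate, List.length_replicate, Fin.ext_iff, ofα, List.map_cons,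
      List.map_nil]
    split_ifs <;> first | rfl | omega

/-- If `τ(a) = a`, then the étale phrase of length `k` whose `l`-th component
is the word `aaa` and whose other components are empty is homotopic to the
empty phrase `(∅)_k`. -/
theorem aaa_contractible_of_fixed
    {α : Type*} [Fintype α] [DecidableEq α] (τ : α → α) (hτ : Function.Involutive τ)
    (k : ℕ) (a : α) (ha : τ a = a) (l : Fin k) :
    EHomotopic τ (P3 k l a) (emptyP k) := by
  rw [EHomotopic, desing_emptyP, P3_eq_oneWord, desing_oneWord_three, emptyP_eq_oneWord a l]
  exact homotopic_oneWord_nil _ _ a τ ha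

end Nano
end

section
/- For any a ∈ α and any indices l₁ < l₂ and m₁ < m₂ in {1,…,k}, the étale phrases P^{2,1;l₁,l₂}_a and P^{1,2;m₁,m₂}_a are not homotopic. -/
namespace Nano

variable {α : Type*}

section LinkSelf

variable {β γ : Type*}

/-- The sum of `g x * h y` over all pairs of entries of a list in which `x` precedes `y`. -/
def pairSum (g h : γ → ZMod 2) : List γ → ZMod 2
  | [] => 0
  | x :: l => g x * (l.map h).sum + pairSum g h l

theorem pairSum_append (g h : γ → ZMod 2) (l l' : List γ) :
    pairSum g h (l ++ l') =
      pairSum g h l + pairSum g h l' + (l.map g).sum * (l'.map h).sum := by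
  induction l with
  | nil => simp [pairSum]
  | cons x l ih => simp [pairSum, ih]; ring

theorem pairSum_congr {g g' h h' : γ → ZMod 2} {l : List γ}
    (hg : ∀ x ∈ l, g x = g' x) (hh : ∀ x ∈ l, h x = h' x) :
    pairSum g h l = pairSum g' h' l := by
  induction l with
  | nil => rfl
  | cons x l ih =>
    simp only [List.forall_mem_cons] at hg hh
    simp only [pairSum, hg.1, ih hg.2 hh.2, List.map_congr_left hh.2]

theorem pairSum_map {δ : Type*} (f : δ → γ) (g h : γ → ZMod 2) (l : List δ) :
    pairSum g h (l.map f) = pairSum (g ∘ f) (h ∘ f) l := by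
  induction l with
  | nil => rfl
  | cons x l ih => simp [pairSum, ih]

variable [DecidableEq β]

/-- The parity weight of an occurrence in component `i` of a letter linking `i` to `j`. -/
def linkWeight (i j : ℕ) (W : List (β × ℕ)) (p : β × ℕ) : ZMod 2 :=
  if p.2 = i then (W.count (p.1, j) : ZMod 2) else 0

/-- The parity weight of an occurrence in component `i` of a letter occurring twice there. -/
def selfWeight (i : ℕ) (W : List (β × ℕ)) (p : β × ℕ) : ZMod 2 :=
  if p.2 = i then (W.count (p.1, i) : ZMod 2) + 1 else 0

/-- The parity of the number of pairs of occurrences in component `i` of a word with entries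
tagged by their components, the first being of a letter shared with component `j` and the second
of a letter occurring twice in component `i`. -/
def linkSelf (i j : ℕ) (W : List (β × ℕ)) : ZMod 2 :=
  pairSum (linkWeight i j W) (selfWeight i W) W

theorem linkSelf_map {β' : Type*} [DecidableEq β'] {f : β → β'} (hf : f.Injective)
    (i j : ℕ) (W : List (β × ℕ)) :
    linkSelf i j (W.map (Prod.map f id)) = linkSelf i j W := by
  have hinj : (Prod.map f (id : ℕ → ℕ)).Injective := hf.prodMap Function.injective_id
  have hc (b : β) (n : ℕ) : (W.map (Prod.map f id)).count (f b, n) = W.count (b, n) :=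
    List.count_map_of_injective W _ hinj (b, n)
  rw [linkSelf, pairSum_map]
  exact pairSum_congr (fun x _ => by simp [linkWeight, hc]) (fun x _ => by simp [selfWeight, hc])

theorem count_eq_zero_of_fst_ne {W : List (β × ℕ)} {A : β} (h : ∀ p ∈ W, p.1 ≠ A) (n : ℕ) :
    W.count (A, n) = 0 :=
  List.count_eq_zero.mpr fun hm => h _ hm rfl

theorem linkSelf_remove_one (i j : ℕ) (X Y : List (β × ℕ)) (A : β) (c : ℕ)
    (hA : ∀ p ∈ X ++ Y, p.1 ≠ A) :
    linkSelf i j (X ++ [(A, c), (A, c)] ++ Y) = linkSelf i j (X ++ Y) := by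
  have hcount (p : β × ℕ) :
      ((X ++ [(A, c), (A, c)] ++ Y).count p : ZMod 2) = ((X ++ Y).count p : ZMod 2) := by
    simp only [List.count_append, List.count_cons, List.count_nil]
    push_cast
    linear_combination CharTwo.add_self_eq_zero (if ((A, c) == p) then (1 : ZMod 2) else 0)
  have h0 := count_eq_zero_of_fst_ne hA
  have hl : linkWeight i j (X ++ [(A, c), (A, c)] ++ Y) = linkWeight i j (X ++ Y) := by
    funext p; simp only [linkWeight, hcount]
  have hs : selfWeight i (X ++ [(A, c), (A, c)] ++ Y) = selfWeight i (X ++ Y) := by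
    funext p; simp only [selfWeight, hcount]
  rw [linkSelf, hl, hs, linkSelf]
  have hz : linkWeight i j (X ++ Y) (A, c) = 0 := by simp [linkWeight, h0]
  have h2 := CharTwo.add_self_eq_zero (selfWeight i (X ++ Y) (A, c))
  simp only [pairSum_append, pairSum, List.map_append, List.map_cons, List.map_nil,
    List.sum_append, List.sum_cons, List.sum_nil, hz]
  linear_combination (X.map (linkWeight i j (X ++ Y))).sum * h2

theorem linkSelf_remove_two {i j : ℕ} (hij : i ≠ j) (X Y Z : List (β × ℕ)) (A B : β) (c d : ℕ)
    (hAB : A ≠ B) (hA : ∀ p ∈ X ++ Y ++ Z, p.1 ≠ A) (hB : ∀ p ∈ X ++ Y ++ Z, p.1 ≠ B) :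
    linkSelf i j (X ++ [(A, c), (B, c)] ++ Y ++ [(B, d), (A, d)] ++ Z) =
      linkSelf i j (X ++ Y ++ Z) := by
  set W := X ++ [(A, c), (B, c)] ++ Y ++ [(B, d), (A, d)] ++ Z with hW
  have hcount (p : β × ℕ) (hp : p ∈ X ++ Y ++ Z) :
      W.count (p.1, i) = (X ++ Y ++ Z).count (p.1, i) ∧
      W.count (p.1, j) = (X ++ Y ++ Z).count (p.1, j) := by
    have h1 := (hA p hp).symm
    have h2 := (hB p hp).symm
    simp [hW, List.count_append, h1, h2]
  have hl : ∀ p ∈ X ++ Y ++ Z, linkWeight i j W p = linkWeight i j (X ++ Y ++ Z) p :=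
    fun p hp => by simp only [linkWeight, hcount p hp]
  have hs : ∀ p ∈ X ++ Y ++ Z, selfWeight i W p = selfWeight i (X ++ Y ++ Z) p :=
    fun p hp => by simp only [selfWeight, hcount p hp]
  rw [linkSelf, linkSelf, ← pairSum_congr hl hs]
  have hA0 := count_eq_zero_of_fst_ne hA
  have hB0 := count_eq_zero_of_fst_ne hB
  simp only [List.count_append, Nat.add_eq_zero_iff] at hA0 hB0
  have hcA (n : ℕ) : (W.count (A, n) : ZMod 2) =
      (if c = n then 1 else 0) + (if d = n then 1 else 0) := by
    simp [hW, List.count_append, List.count_cons, hA0, hAB.symm, add_comm]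
  have hcB (n : ℕ) : (W.count (B, n) : ZMod 2) =
      (if c = n then 1 else 0) + (if d = n then 1 else 0) := by
    simp [hW, List.count_append, List.count_cons, hB0, hAB, add_comm]
  have hlB (n : ℕ) : linkWeight i j W (B, n) = linkWeight i j W (A, n) := by
    simp only [linkWeight, hcA, hcB]
  have hsB (n : ℕ) : selfWeight i W (B, n) = selfWeight i W (A, n) := by
    simp only [selfWeight, hcA, hcB]
  have hc : linkWeight i j W (A, c) * selfWeight i W (A, c) = 0 := by
    simp only [linkWeight, selfWeight, hcA]
    split_ifs <;> first | decide | exact absurd (by omega) hij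
  have hd : linkWeight i j W (A, d) * selfWeight i W (A, d) = 0 := by
    simp only [linkWeight, selfWeight, hcA]
    split_ifs <;> first | decide | exact absurd (by omega) hij
  have l2 (n : ℕ) := CharTwo.add_self_eq_zero (linkWeight i j W (A, n))
  have s2 (n : ℕ) := CharTwo.add_self_eq_zero (selfWeight i W (A, n))
  generalize linkWeight i j W = g at *
  generalize selfWeight i W = h at *
  rw [hW]
  simp only [pairSum_append, pairSum, List.map_append, List.map_cons, List.map_nil,
    List.sum_append, List.sum_cons, List.sum_nil, hlB, hsB]
  linear_combination hc + hd + (X.map g).sum * (s2 c + s2 d) +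
    (Y.map g).sum * s2 d + (Y.map h).sum * l2 c + (Z.map h).sum * (l2 c + l2 d)
      + (h (A, d) + h (A, d)) * l2 c

theorem linkSelf_swap_three {i j : ℕ} (hij : i ≠ j) (X Y Z T : List (β × ℕ)) (A B C : β)
    (c d e : ℕ) (hAB : A ≠ B) (hAC : A ≠ C) (hBC : B ≠ C)
    (hA : ∀ p ∈ X ++ Y ++ Z ++ T, p.1 ≠ A) (hB : ∀ p ∈ X ++ Y ++ Z ++ T, p.1 ≠ B)
    (hC : ∀ p ∈ X ++ Y ++ Z ++ T, p.1 ≠ C) :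
    linkSelf i j (X ++ [(A, c), (B, c)] ++ Y ++ [(A, d), (C, d)] ++ Z ++ [(B, e), (C, e)] ++ T) =
      linkSelf i j
        (X ++ [(B, c), (A, c)] ++ Y ++ [(C, d), (A, d)] ++ Z ++ [(C, e), (B, e)] ++ T) := by
  set W := X ++ [(A, c), (B, c)] ++ Y ++ [(A, d), (C, d)] ++ Z ++ [(B, e), (C, e)] ++ T with hW
  set W' := X ++ [(B, c), (A, c)] ++ Y ++ [(C, d), (A, d)] ++ Z ++ [(C, e), (B, e)] ++ T with hW'
  have hcount (p : β × ℕ) : W'.count p = W.count p := by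
    simp only [hW, hW', List.count_append, List.count_cons, List.count_nil]; omega
  have hl : linkWeight i j W' = linkWeight i j W := by
    funext p; simp only [linkWeight, hcount]
  have hs : selfWeight i W' = selfWeight i W := by
    funext p; simp only [selfWeight, hcount]
  rw [linkSelf, linkSelf, hl, hs]
  have hA0 := count_eq_zero_of_fst_ne hA
  have hB0 := count_eq_zero_of_fst_ne hB
  have hC0 := count_eq_zero_of_fst_ne hC
  simp only [List.count_append, Nat.add_eq_zero_iff] at hA0 hB0 hC0
  have hcA (n : ℕ) : (W.count (A, n) : ZMod 2) =
      (if c = n then 1 else 0) + (if d = n then 1 else 0) := by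
    simp [hW, List.count_append, List.count_cons, hA0, hAB.symm, hAC.symm, add_comm]
  have hcB (n : ℕ) : (W.count (B, n) : ZMod 2) =
      (if c = n then 1 else 0) + (if e = n then 1 else 0) := by
    simp [hW, List.count_append, List.count_cons, hB0, hAB, hBC.symm, add_comm]
  have hcC (n : ℕ) : (W.count (C, n) : ZMod 2) =
      (if d = n then 1 else 0) + (if e = n then 1 else 0) := by
    simp [hW, List.count_append, List.count_cons, hC0, hAC, hBC, add_comm]
  have key : linkWeight i j W (A, c) * selfWeight i W (B, c)
        + linkWeight i j W (A, d) * selfWeight i W (C, d)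
        + linkWeight i j W (B, e) * selfWeight i W (C, e)
      = linkWeight i j W (B, c) * selfWeight i W (A, c)
        + linkWeight i j W (C, d) * selfWeight i W (A, d)
        + linkWeight i j W (C, e) * selfWeight i W (B, e) := by
    simp only [linkWeight, selfWeight, hcA, hcB, hcC]
    split_ifs <;> first | decide | exact absurd (by omega) hij
  generalize linkWeight i j W = g at *
  generalize selfWeight i W = h at *
  rw [hW, hW']
  simp only [pairSum_append, pairSum, List.map_append, List.map_cons, List.map_nil,
    List.sum_append, List.sum_cons, List.sum_nil]
  linear_combination key

end LinkSelf

section Tagging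

/-- The letters of a sequence with separators, each tagged with its component; the components are
numbered from `c`. -/
def tag {β : Type*} : ℕ → List (Option β) → List (β × ℕ)
  | _, [] => []
  | c, none :: l => tag (c + 1) l
  | c, some A :: l => (A, c) :: tag c l

theorem tag_append {β : Type*} (c : ℕ) (l l' : List (Option β)) :
    tag c (l ++ l') = tag c l ++ tag (c + l.countP Option.isNone) l' := by
  induction l generalizing c with
  | nil => rfl
  | cons x l ih => cases x <;> simp [tag, ih, Nat.add_assoc, Nat.add_comm 1]

theorem tag_map_some_append_none {β : Type*} (c : ℕ) (w : List β) (l : List (Option β)) :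
    tag c (w.map some ++ none :: l) = w.map (·, c) ++ tag (c + 1) l := by
  induction w with
  | nil => rfl
  | cons A w ih => simp [tag, ih]

theorem tag_map_some {β : Type*} (c : ℕ) (w : List β) :
    tag c (w.map some) = w.map (·, c) := by
  induction w with
  | nil => rfl
  | cons A w ih => simp [tag, ih]

@[simp]
theorem tag_flat_nil (c : ℕ) : tag c (flat ([] : Phrase α)) = [] := rfl

@[simp]
theorem tag_flat_cons (c : ℕ) (w : List (Letter α)) (P : Phrase α) :
    tag c (flat (w :: P)) = w.map (·, c) ++ tag (c + 1) (flat P) := by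
  cases P with
  | nil => simpa [flat, tag] using tag_map_some c w
  | cons w' P =>
    simpa [flat, List.intercalate] using tag_map_some_append_none c w (flat (w' :: P))

theorem map_fst_tag_flat (c : ℕ) (P : Phrase α) : (tag c (flat P)).map Prod.fst = P.flatten := by
  induction P generalizing c with
  | nil => rfl
  | cons w P ih => simp [ih, Function.comp_def]

theorem tag_flat_rename (f : ℕ → ℕ) (c : ℕ) (P : Phrase α) :
    tag c (flat (rename f P)) = (tag c (flat P)).map (Prod.map (Prod.map f id) id) := by
  induction P generalizing c with
  | nil => rfl
  | cons w P ih =>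
    have h := ih (c + 1)
    simp only [rename] at h
    simp [rename, h, Prod.map, Function.comp_def]

theorem tag_flat_replicate_append (c n : ℕ) (P : Phrase α) :
    tag c (flat (List.replicate n [] ++ P)) = tag (c + n) (flat P) := by
  induction n generalizing c with
  | zero => rfl
  | succ n ih => simp [List.replicate_succ, ih, Nat.add_assoc, Nat.add_comm 1]

theorem tag_flat_ofFn_ite {k : ℕ} {l1 l2 : Fin k} (hl : l1 < l2) (u v : List (Letter α)) :
    tag 0 (flat (List.ofFn fun i => if i = l1 then u else if i = l2 then v else [])) =
      u.map (·, (l1 : ℕ)) ++ v.map (·, (l2 : ℕ)) := by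
  have hl' : (l1 : ℕ) < l2 := hl
  have hP : (List.ofFn fun i => if i = l1 then u else if i = l2 then v else []) =
      List.replicate l1 [] ++ u ::
        (List.replicate (l2 - l1 - 1) [] ++ v :: (List.replicate (k - 1 - l2) [] ++ [])) := by
    refine List.ext_getElem (by simp; omega) fun n h1 h2 => ?_
    simp only [List.getElem_ofFn, List.getElem_append, List.getElem_cons, List.getElem_replicate,
      List.length_replicate, Fin.ext_iff]
    grind
  rw [hP, tag_flat_replicate_append, tag_flat_cons, tag_flat_replicate_append, tag_flat_cons,
    tag_flat_replicate_append]
  rw [show 0 + (l1 : ℕ) + 1 + (l2 - l1 - 1) = l2 by omega]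
  simp

end Tagging

section Invariance

variable [DecidableEq α]

theorem Move.linkSelf_eq {τ : α → α} {P Q : Phrase α} (h : Move τ P Q) (hP : IsGauss P)
    {i j : ℕ} (hij : i ≠ j) :
    linkSelf i j (tag 0 (flat P)) = linkSelf i j (tag 0 (flat Q)) := by
  have hG (A : Letter α) : ((tag 0 (flat P)).map Prod.fst).count A ≤ 2 := by
    rw [map_fst_tag_flat]
    by_cases hA : A ∈ P.flatten
    · exact (hP A hA).le
    · simp [List.count_eq_zero.mpr hA]
  have hne {A : Letter α} {V : List (Letter α × ℕ)} (hV : (V.map Prod.fst).count A = 0) :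
      ∀ p ∈ V, p.1 ≠ A := by
    rintro p hp rfl
    exact List.count_eq_zero.mp hV (List.mem_map_of_mem hp)
  cases h with
  | iso f hf =>
    rw [tag_flat_rename, linkSelf_map (hf.prodMap Function.injective_id)]
  | h1 _ _ A x y hP hQ =>
    have hA := hG A
    simp only [hP, hQ, tag_append, tag, List.countP_append, List.countP_cons,
      List.countP_nil, Option.isNone_some, Bool.false_eq_true, if_false, Nat.add_zero,
      List.map_append, List.map_cons, List.map_nil,
      List.count_append, List.count_cons, List.count_nil, BEq.rfl, if_true] at hA ⊢
    refine linkSelf_remove_one _ _ _ _ _ _ (hne ?_)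
    simp only [List.map_append, List.count_append]
    omega
  | h2 _ _ A B x y z _ hP hQ =>
    have hA := hG A
    have hB := hG B
    simp only [hP, hQ, tag_append, tag, List.countP_append, List.countP_cons,
      List.countP_nil, Option.isNone_some, Bool.false_eq_true, if_false, Nat.add_zero,
      List.map_append, List.map_cons, List.map_nil,
      List.count_append, List.count_cons, List.count_nil, BEq.rfl, if_true] at hA hB ⊢
    have hAB : A ≠ B := by
      rintro rfl
      simp only [BEq.rfl, if_true] at hA
      omega
    refine linkSelf_remove_two hij _ _ _ _ _ _ _ hAB (hne ?_) (hne ?_)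
    all_goals
      simp only [List.map_append, List.count_append]
      omega
  | h3 _ _ A B C x y z t _ _ hP hQ =>
    have hA := hG A
    have hB := hG B
    have hC := hG C
    simp only [hP, hQ, tag_append, tag, List.countP_append, List.countP_cons,
      List.countP_nil, Option.isNone_some, Bool.false_eq_true, if_false, Nat.add_zero,
      List.map_append, List.map_cons, List.map_nil,
      List.count_append, List.count_cons, List.count_nil, BEq.rfl, if_true] at hA hB hC ⊢
    have hAB : A ≠ B := by
      rintro rfl
      simp only [BEq.rfl, if_true] at hA
      omega
    have hAC : A ≠ C := by
      rintro rfl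
      simp only [BEq.rfl, if_true] at hA
      omega
    have hBC : B ≠ C := by
      rintro rfl
      simp only [BEq.rfl, if_true] at hB
      omega
    refine linkSelf_swap_three hij _ _ _ _ _ _ _ _ _ _ hAB hAC hBC (hne ?_) (hne ?_) (hne ?_)
    all_goals
      simp only [List.map_append, List.count_append]
      omega

theorem HomotopicIn.linkSelf_eq {τ : α → α} {s : Set α} {P Q : Phrase α}
    (h : HomotopicIn τ s P Q) {i j : ℕ} (hij : i ≠ j) :
    linkSelf i j (tag 0 (flat P)) = linkSelf i j (tag 0 (flat Q)) := by
  induction h with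
  | refl => rfl
  | tail _ hstep ih =>
    obtain ⟨hm | hm, hX, hY⟩ := hstep
    · exact ih.trans (hm.linkSelf_eq hX.1 hij)
    · exact ih.trans (hm.linkSelf_eq hY.1 hij).symm

end Invariance

section Desingularization

variable [DecidableEq α]

/-- The desingularization of a word whose entries are tagged by their components. -/
def desingTagged (m : Letter α → ℕ) :
    List (Letter α × ℕ) → (Letter α → ℕ) → List (Letter α × ℕ)
  | [], _ => []
  | (A, c) :: l, seen =>
      (repl A (seen A + 1) (m A)).map (·, c) ++
        desingTagged m l (fun B => if B = A then seen B + 1 else seen B)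

theorem desingTagged_map_append (m : Letter α → ℕ) (c : ℕ) (w : List (Letter α))
    (l : List (Letter α × ℕ)) (seen : Letter α → ℕ) :
    desingTagged m (w.map (·, c) ++ l) seen =
      (desingWord m w seen).map (·, c) ++ desingTagged m l (fun B => seen B + w.count B) := by
  induction w generalizing seen with
  | nil => simp [desingWord]
  | cons A w ih =>
    have hseen : (fun B => (if B = A then seen B + 1 else seen B) + w.count B) =
        fun B => seen B + (A :: w).count B := by
      funext B
      simp only [List.count_cons, beq_iff_eq, eq_comm (a := A)]
      split_ifs <;> omega
    simp [desingTagged, desingWord, ih, hseen]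

theorem tag_flat_desingAux (m : Letter α → ℕ) (c : ℕ) (P : Phrase α) (seen : Letter α → ℕ) :
    tag c (flat (desingAux m P seen)) = desingTagged m (tag c (flat P)) seen := by
  induction P generalizing c seen with
  | nil => rfl
  | cons w P ih => simp [desingAux, ih, desingTagged_map_append]

theorem tag_flat_desing (c : ℕ) (P : Phrase α) :
    tag c (flat (desing P)) =
      desingTagged (fun A => ((tag c (flat P)).map Prod.fst).count A) (tag c (flat P))
        (fun _ => 0) := by
  rw [map_fst_tag_flat, desing, tag_flat_desingAux]

theorem tag_flat_desing_P21 {k : ℕ} (a : α) {l1 l2 : Fin k} (hl : l1 < l2) :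
    tag 0 (flat (desing (P21 k l1 l2 a))) =
      [(dLetter (ofα a) 1 2, (l1 : ℕ)), (dLetter (ofα a) 1 3, (l1 : ℕ)),
        (dLetter (ofα a) 1 2, (l1 : ℕ)), (dLetter (ofα a) 2 3, (l1 : ℕ)),
        (dLetter (ofα a) 1 3, (l2 : ℕ)), (dLetter (ofα a) 2 3, (l2 : ℕ))] := by
  rw [tag_flat_desing, P21, tag_flat_ofFn_ite hl]
  simp [desingTagged, repl, List.range_succ]

theorem tag_flat_desing_P12 {k : ℕ} (a : α) {l1 l2 : Fin k} (hl : l1 < l2) :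
    tag 0 (flat (desing (P12 k l1 l2 a))) =
      [(dLetter (ofα a) 1 2, (l1 : ℕ)), (dLetter (ofα a) 1 3, (l1 : ℕ)),
        (dLetter (ofα a) 1 2, (l2 : ℕ)), (dLetter (ofα a) 2 3, (l2 : ℕ)),
        (dLetter (ofα a) 1 3, (l2 : ℕ)), (dLetter (ofα a) 2 3, (l2 : ℕ))] := by
  rw [tag_flat_desing, P12, tag_flat_ofFn_ite hl]
  simp [desingTagged, repl, List.range_succ]

theorem linkSelf_desing_P21 {k : ℕ} (a : α) {l1 l2 : Fin k} (hl : l1 < l2) :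
    linkSelf l1 l2 (tag 0 (flat (desing (P21 k l1 l2 a)))) = 1 := by
  have h : (l1 : ℕ) ≠ l2 := Fin.val_ne_of_ne hl.ne
  rw [tag_flat_desing_P21 a hl]
  simp [linkSelf, pairSum, linkWeight, selfWeight, dLetter, Nat.pair_eq_pair, h, h.symm]
  decide

theorem linkSelf_desing_P12 {k : ℕ} (a : α) {l1 l2 m1 m2 : Fin k} (hl : l1 < l2) (hm : m1 < m2) :
    linkSelf l1 l2 (tag 0 (flat (desing (P12 k m1 m2 a)))) = 0 := by
  have h1 : (l1 : ℕ) < l2 := hl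
  have h2 : (m1 : ℕ) < m2 := hm
  rw [tag_flat_desing_P12 a hm]
  simp [linkSelf, pairSum, linkWeight, selfWeight, List.count_cons, dLetter, Nat.pair_eq_pair]
  split_ifs <;> first | decide | omega

end Desingularization

/-- For any `a ∈ α` and any indices `l₁ < l₂` and `m₁ < m₂` in `{1,…,k}`,
the étale phrases `P^{2,1;l₁,l₂}_a` and `P^{1,2;m₁,m₂}_a` are not homotopic. -/
theorem P21_not_homotopic_P12
    {α : Type*} [Fintype α] [DecidableEq α] (τ : α → α) (hτ : Function.Involutive τ)
    (k : ℕ) (a : α) (l1 l2 m1 m2 : Fin k) (hl : l1 < l2) (hm : m1 < m2) :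
    ¬ EHomotopic τ (P21 k l1 l2 a) (P12 k m1 m2 a) := by
  intro h
  have key := h.linkSelf_eq (Fin.val_ne_of_ne hl.ne)
  rw [linkSelf_desing_P21 a hl, linkSelf_desing_P12 a hl hm] at key
  exact one_ne_zero key

end Nano
end
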